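/- Let m, d ≥ 1 and let L be a subgroup of ℤ^m of index exactly d^m. Suppose a₁, …, a_m ∈ L are ℤ-linearly independent, nonnegative, and deg(a_j) ≤ d for every j. Then L = d·ℤ^m = {a : Fin m → ℤ | d divides a(i) for all i}, and there is a permutation σ of Fin m such that a_j = d·e_{σ(j)} for every j, where e_i denotes the i-th standard basis vector. (This is the lattice core of the characterization of equality in the lower bound γ_field(G,V) ≥ |G|^{1/m}.) -/

import Mathlib

open Finset in
/-- Expanding the product of the row sums of `A`, the terms indexed by permutations add up to the
permanent of the transpose. -/
lemma Matrix.permanent_transpose_add_sum_not_injective {n R : Type*} [Fintype n] [DecidableEq n]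
    [CommSemiring R] (A : Matrix n n R) :
    A.transpose.permanent + ∑ f : n → n with ¬ Function.Injective f, ∏ i, A i (f i) =
      ∏ i, ∑ j, A i j := by
  rw [prod_univ_sum (fun _ => univ) (fun i j => A i j), Fintype.piFinset_univ,
    ← sum_filter_add_sum_filter_not univ (fun f : n → n => Function.Injective f)]
  congr 1
  refine sum_bij (fun (σ : Equiv.Perm n) _ => (σ : n → n)) ?_ ?_ ?_ ?_
  · exact fun σ _ => mem_filter.2 ⟨mem_univ _, σ.injective⟩
  · exact fun σ _ τ _ h => DFunLike.coe_injective h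
  · intro f hf
    exact ⟨Equiv.ofBijective f (Finite.injective_iff_bijective.1 (mem_filter.1 hf).2),
      mem_univ _, rfl⟩
  · exact fun σ _ => rfl

lemma Matrix.abs_det_le_permanent {n R : Type*} [Fintype n] [DecidableEq n] [CommRing R]
    [LinearOrder R] [IsStrictOrderedRing R] (A : Matrix n n R) (hA : ∀ i j, 0 ≤ A i j) :
    |A.det| ≤ A.permanent := by
  rw [Matrix.det_apply, Matrix.permanent]
  refine (Finset.abs_sum_le_sum_abs _ _).trans (Finset.sum_le_sum fun σ _ => le_of_eq ?_)
  have h : 0 ≤ ∏ i, A (σ i) i := Finset.prod_nonneg fun i _ => hA _ _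
  rcases Int.units_eq_one_or (Equiv.Perm.sign σ) with hs | hs <;>
    simp [hs, abs_of_nonneg h]

/-- A nonnegative matrix with row sums at most `d` whose determinant has absolute value at least
`d ^ n` is `d` times a permutation matrix. -/
lemma Matrix.exists_perm_eq_of_pow_le_abs_det {n R : Type*} [Fintype n] [DecidableEq n]
    [CommRing R] [LinearOrder R] [IsStrictOrderedRing R]
    (A : Matrix n n R) (hA : ∀ i j, 0 ≤ A i j) {d : R} (hd : 0 < d)
    (hsum : ∀ i, ∑ j, A i j ≤ d) (hdet : d ^ Fintype.card n ≤ |A.det|) :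
    ∃ σ : Equiv.Perm n, ∀ i, A i = fun j => if j = σ i then d else 0 := by
  have hper : d ^ Fintype.card n ≤ A.transpose.permanent := by
    rw [← Matrix.det_transpose] at hdet
    exact hdet.trans (A.transpose.abs_det_le_permanent fun i j => hA j i)
  have hpow : 0 < d ^ Fintype.card n := pow_pos hd _
  have hterm : ∀ f : n → n, 0 ≤ ∏ i, A i (f i) := fun f => Finset.prod_nonneg fun i _ => hA _ _
  have hexp := A.permanent_transpose_add_sum_not_injective
  have hprod : d ^ Fintype.card n ≤ ∏ i, ∑ j, A i j :=
    hexp ▸ hper.trans (le_add_of_nonneg_right (Finset.sum_nonneg fun f _ => hterm f))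
  have hpos : ∀ i, 0 < ∑ j, A i j := fun i =>
    lt_of_le_of_ne (Finset.sum_nonneg fun j _ => hA i j)
      (Finset.prod_ne_zero_iff.1 (hpow.trans_le hprod).ne' i (Finset.mem_univ i)).symm
  have hcard : ∏ _i : n, d = d ^ Fintype.card n := by simp
  have hrow : ∀ i, ∑ j, A i j = d := by
    intro i
    by_contra h
    have hlt := Finset.prod_lt_prod (s := Finset.univ) (fun i _ => hpos i) (fun i _ => hsum i)
      ⟨i, Finset.mem_univ i, lt_of_le_of_ne (hsum i) h⟩
    exact absurd hprod (not_le.2 (hlt.trans_eq hcard))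
  have hzero : ∀ f : n → n, ¬ Function.Injective f → ∏ i, A i (f i) = 0 := by
    intro f hf
    simp only [hrow, hcard] at hexp
    have hle := Finset.single_le_sum (f := fun g : n → n => ∏ i, A i (g i))
      (s := {g | ¬ Function.Injective g}) (fun g _ => hterm g)
      (Finset.mem_filter.2 ⟨Finset.mem_univ f, hf⟩)
    exact le_antisymm (by linarith) (hterm f)
  obtain ⟨σ, -, hσ⟩ := Finset.exists_ne_zero_of_sum_ne_zero (hpow.trans_le hper).ne'
  have hσ_ne : ∀ i, A i (σ i) ≠ 0 := fun i =>
    Finset.prod_ne_zero_iff.1 hσ i (Finset.mem_univ i)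
  have hoff : ∀ i j, j ≠ σ i → A i j = 0 := by
    intro i j hj
    by_contra hne
    refine Finset.prod_ne_zero_iff.2 (fun k _ => ?_) (hzero (Function.update σ i j) fun hinj => ?_)
    · rcases eq_or_ne k i with rfl | hk
      · simpa using hne
      · simpa [Function.update_of_ne hk] using hσ_ne k
    · have hk : σ.symm j ≠ i := fun h => hj (by rw [← h, Equiv.apply_symm_apply])
      exact hk (hinj (by simp [Function.update_of_ne hk]))
  refine ⟨σ, fun i => funext fun j => ?_⟩
  split_ifs with h
  · rw [h, ← hrow i, Finset.sum_eq_single (σ i) (fun j _ hj => hoff i j hj) (by simp)]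
  · exact hoff i j h

lemma Matrix.det_ne_zero_of_linearIndependent_rows {n R : Type*} [Fintype n] [DecidableEq n]
    [CommRing R] [IsDomain R] {A : Matrix n n R} (hA : LinearIndependent R A) : A.det ≠ 0 := by
  intro h
  obtain ⟨v, hv, hvA⟩ := Matrix.exists_vecMul_eq_zero_iff.2 h
  refine hv (funext (Fintype.linearIndependent_iff.1 hA v ?_))
  rw [← hvA, Matrix.vecMul_eq_sum]

lemma AddSubgroup.index_span_rows {n : Type*} [Fintype n] [DecidableEq n] {A : Matrix n n ℤ}
    (hA : LinearIndependent ℤ A) :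
    (Submodule.span ℤ (Set.range A)).toAddSubgroup.index = A.det.natAbs := by
  rw [AddSubgroup.index_eq_natAbs_det (Pi.basisFun ℤ n) _ (Module.Basis.span hA), Pi.basisFun_det]
  congr 2
  ext i j
  exact congrFun (Module.Basis.coe_span_apply hA i) j

/-- Let `m, d ≥ 1` and let `L ≤ ℤ^m` have index exactly `d^m`. If
`a 0, …, a (m-1) ∈ L` are `ℤ`-linearly independent, nonnegative, and of degree `≤ d`, then
`L = d·ℤ^m` and, after a permutation `σ`, each `a j` equals `d` times the `σ j`-th standard
basis vector. -/
theorem stmt_3 (m d : ℕ) (hm : 1 ≤ m) (hd : 1 ≤ d) (L : AddSubgroup (Fin m → ℤ))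
    (hidx : L.index = d ^ m)
    (a : Fin m → (Fin m → ℤ)) (haL : ∀ j, a j ∈ L) (hind : LinearIndependent ℤ a)
    (hpos : ∀ j i, 0 ≤ a j i) (hdeg : ∀ j, ∑ i, a j i ≤ (d : ℤ)) :
    (∀ x : Fin m → ℤ, x ∈ L ↔ ∀ i, (d : ℤ) ∣ x i) ∧
      ∃ σ : Equiv.Perm (Fin m), ∀ j, a j = fun i => if i = σ j then (d : ℤ) else 0 := by
  have hdet : Matrix.det a ≠ 0 := Matrix.det_ne_zero_of_linearIndependent_rows hind
  have hspan : (Submodule.span ℤ (Set.range a)).toAddSubgroup ≤ L := by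
    change Submodule.span ℤ (Set.range a) ≤ AddSubgroup.toIntSubmodule L
    exact Submodule.span_le.2 (Set.range_subset_iff.2 haL)
  have hindex := AddSubgroup.index_span_rows hind
  have hle : d ^ m ≤ (Matrix.det a).natAbs := by
    rw [← hidx, ← hindex]
    exact Nat.le_of_dvd (by rw [hindex]; exact Int.natAbs_pos.2 hdet)
      (AddSubgroup.index_dvd_of_le hspan)
  obtain ⟨σ, hσ⟩ := Matrix.exists_perm_eq_of_pow_le_abs_det a hpos (d := (d : ℤ))
    (by exact_mod_cast hd) hdeg
    (by rw [Fintype.card_fin, Int.abs_eq_natAbs]; exact_mod_cast hle)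
  refine ⟨?_, σ, hσ⟩
  have hdvd : ∀ x ∈ Submodule.span ℤ (Set.range a), ∀ i, (d : ℤ) ∣ x i := by
    intro x hx i
    obtain ⟨c, rfl⟩ := (Submodule.mem_span_range_iff_exists_fun ℤ).1 hx
    rw [Finset.sum_apply]
    refine Finset.dvd_sum fun j _ => ?_
    rw [hσ j, Pi.smul_apply, smul_eq_mul]
    split_ifs <;> simp
  have hmat : (Matrix.of a : Matrix (Fin m) (Fin m) ℤ) =
      (Matrix.diagonal fun _ => (d : ℤ)).submatrix σ id := by
    ext i j
    simp [hσ i, Matrix.diagonal_apply, eq_comm]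
  have hnatAbs : (Matrix.det a).natAbs = d ^ m := by
    change (Matrix.of a).det.natAbs = d ^ m
    rw [hmat, Matrix.det_permute, Int.natAbs_mul, Int.cast_id, Int.units_natAbs]
    simp [Int.natAbs_pow]
  have hrel : (Submodule.span ℤ (Set.range a)).toAddSubgroup.relIndex L = 1 := by
    have h := AddSubgroup.relIndex_mul_index hspan
    rw [hindex, hnatAbs, hidx] at h
    exact Nat.eq_of_mul_eq_mul_right (pow_pos hd m) (by rw [h, one_mul])
  refine fun x => ⟨fun hx => hdvd x (AddSubgroup.relIndex_eq_one.1 hrel hx), fun hx => ?_⟩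
  choose c hc using hx
  have hsum : x = ∑ j, c (σ j) • a j := by
    ext i
    rw [Finset.sum_apply, Finset.sum_eq_single (σ.symm i)]
    · simp [hσ, hc i, mul_comm]
    · intro j _ hj
      have hij : i ≠ σ j := fun h => hj (by rw [h, Equiv.symm_apply_apply])
      simp [hσ, hij]
    · simp
  rw [hsum]
  exact AddSubgroup.sum_mem L fun j _ => AddSubgroup.zsmul_mem L (haL j) _
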